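/- arXiv:2104.08669 — 3 statements merged into one kernel-verified Lean document; each statement's English description precedes it below -/
import Mathlib

section
/- (Williamson's theorem) For any 2n×2n real symmetric positive definite matrix A there exists a real symplectic matrix S (Sᵀ J_n S = J_n) and an n×n positive diagonal matrix Σ such that S A Sᵀ = diag(Σ, Σ). -/
open Matrix

/-- Symplectic family for an injective skew-adjoint operator. -/
theorem williamson_family {E : Type*} [NormedAddCommGroup E] [InnerProductSpace ℝ E]
    [FiniteDimensional ℝ E] (T : E →ₗ[ℝ] E)
    (hT : ∀ x y, inner ℝ (T x) y = - inner ℝ x (T y)) (hinj : ∀ x, T x = 0 → x = 0)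
    (n : ℕ) (hn : Module.finrank ℝ E = n + n) (m : ℕ) (hm : m ≤ n) :
    ∃ (u : Fin m → E) (σ : Fin m → ℝ), (∀ i, 0 < σ i) ∧
      (∀ i, inner ℝ (u i) (u i) = σ i) ∧
      (∀ i j, i ≠ j → inner ℝ (u i) (u j) = 0) ∧
      (∀ i j, inner ℝ (u i) (T (u j)) = 0) ∧
      (∀ i, T (T (u i)) = -(((σ i) ^ 2)⁻¹ • u i)) := by
  induction m with
  | zero =>
    exact ⟨fun i => i.elim0, fun i => i.elim0, fun i => i.elim0, fun i => i.elim0,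
      fun i => i.elim0, fun i => i.elim0, fun i => i.elim0⟩
  | succ m ih =>
    obtain ⟨u, σ, h1, h2, h3, h4, h5⟩ := ih (by omega)
    set W : Submodule ℝ E := (Submodule.span ℝ (Set.range (Sum.elim u (fun i => T (u i)))))ᗮ
      with hW
    have hmem : ∀ w, w ∈ W ↔ (∀ i, inner ℝ (u i) w = 0) ∧ (∀ i, inner ℝ (T (u i)) w = 0) := by
      intro w
      rw [hW, Submodule.mem_orthogonal]
      constructor
      · intro h
        exact ⟨fun i => h _ (Submodule.subset_span ⟨Sum.inl i, rfl⟩),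
          fun i => h _ (Submodule.subset_span ⟨Sum.inr i, rfl⟩)⟩
      · rintro ⟨ha, hb⟩ z hz
        induction hz using Submodule.span_induction with
        | mem x hx =>
          obtain ⟨i | i, rfl⟩ := hx
          · exact ha i
          · exact hb i
        | zero => simp
        | add x y _ _ hx hy => rw [inner_add_left, hx, hy, add_zero]
        | smul a x _ hx => rw [real_inner_smul_left, hx, mul_zero]
    have hTW : ∀ w ∈ W, T w ∈ W := by
      intro w hw
      rw [hmem] at hw ⊢
      constructor
      · intro i
        have := hT (u i) w
        rw [hw.2 i] at this
        linarith
      · intro i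
        have := hT (T (u i)) w
        rw [h5, inner_neg_left, real_inner_smul_left, hw.1 i] at this
        linarith
    have hdim : 0 < Module.finrank ℝ W := by
      have ha := Submodule.finrank_add_finrank_orthogonal
        (Submodule.span ℝ (Set.range (Sum.elim u (fun i => T (u i)))))
      have hb := finrank_range_le_card (R := ℝ) (Sum.elim u (fun i => T (u i)))
      rw [Set.finrank] at hb
      simp only [Fintype.card_sum, Fintype.card_fin] at hb
      rw [← hW] at ha
      omega
    have : Nontrivial W := Module.finrank_pos_iff.mp hdim
    let Q : W →ₗ[ℝ] W := (T ∘ₗ T).restrict (fun w hw => hTW _ (hTW _ hw))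
    have hQ : Q.IsSymmetric := by
      intro x y
      change inner ℝ (T (T (x : E))) (y : E) = inner ℝ (x : E) (T (T (y : E)))
      rw [hT, hT, neg_neg]
    have hev := hQ.hasEigenvalue_iSup_of_finiteDimensional
    obtain ⟨w, hw⟩ := hev.exists_hasEigenvector
    obtain ⟨μ, hμ⟩ : ∃ μ : ℝ, Q w = μ • w := ⟨_, hw.apply_eq_smul⟩
    have hw0 : (w : E) ≠ 0 := fun h => hw.2 (by ext; exact h)
    have hμ' : T (T (w : E)) = μ • (w : E) := congrArg Subtype.val hμ
    have hTw0 : T (w : E) ≠ 0 := fun h => hw0 (hinj _ h)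
    have p1 : 0 < inner ℝ (w : E) (w : E) := real_inner_self_pos.mpr hw0
    have p2 : 0 < inner ℝ (T (w : E)) (T (w : E)) := real_inner_self_pos.mpr hTw0
    have hμneg : μ < 0 := by
      rw [hT, hμ', real_inner_smul_right] at p2
      by_contra h
      push Not at h
      have := mul_nonneg h p1.le
      linarith
    -- the new symplectic eigenvalue
    let s : ℝ := (Real.sqrt (-μ))⁻¹
    have hs : 0 < s := inv_pos.mpr (Real.sqrt_pos.mpr (by linarith))
    have hs2 : (s ^ 2)⁻¹ = -μ := by
      simp only [s, inv_pow, inv_inv]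
      exact Real.sq_sqrt (by linarith)
    let a : ℝ := Real.sqrt (s / inner ℝ (w : E) (w : E))
    have ha : a * a = s / inner ℝ (w : E) (w : E) := Real.mul_self_sqrt (by positivity)
    have hwW := (hmem _).1 w.2
    have hself : inner ℝ (w : E) (T (w : E)) = 0 := by
      have := hT (w : E) (w : E)
      rw [real_inner_comm] at this
      linarith
    have hTwW := (hmem _).1 (hTW _ w.2)
    refine ⟨Fin.cons (a • (w : E)) u, Fin.cons s σ, ?_, ?_, ?_, ?_, ?_⟩
    · intro i
      refine Fin.cases ?_ (fun i => ?_) i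
      · simpa using hs
      · simpa using h1 i
    · intro i
      refine Fin.cases ?_ (fun i => ?_) i
      · simp only [Fin.cons_zero, real_inner_smul_left, real_inner_smul_right]
        rw [← mul_assoc, ha]
        field_simp
      · simpa only [Fin.cons_succ] using h2 i
    · intro i j
      refine Fin.cases ?_ (fun i => ?_) i <;> refine Fin.cases ?_ (fun j => ?_) j
      · simp
      · intro _
        simp only [Fin.cons_zero, Fin.cons_succ, real_inner_smul_left]
        rw [real_inner_comm, hwW.1 j, mul_zero]
      · intro _
        simp only [Fin.cons_zero, Fin.cons_succ, real_inner_smul_right]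
        rw [hwW.1 i, mul_zero]
      · intro h
        simp only [Fin.cons_succ]
        exact h3 i j (fun e => h (by rw [e]))
    · intro i j
      refine Fin.cases ?_ (fun i => ?_) i <;> refine Fin.cases ?_ (fun j => ?_) j
      · simp only [Fin.cons_zero, map_smul, real_inner_smul_left, real_inner_smul_right, hself,
          mul_zero]
      · simp only [Fin.cons_zero, Fin.cons_succ, real_inner_smul_left]
        rw [real_inner_comm, hwW.2 j, mul_zero]
      · simp only [Fin.cons_zero, Fin.cons_succ, map_smul, real_inner_smul_right]
        rw [hTwW.1 i, mul_zero]
      · simpa only [Fin.cons_succ] using h4 i j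
    · intro i
      refine Fin.cases ?_ (fun i => ?_) i
      · simp only [Fin.cons_zero, map_smul, hμ', hs2]
        rw [smul_comm, neg_smul, neg_neg]
      · simpa only [Fin.cons_succ] using h5 i

open scoped MatrixOrder ComplexOrder in
theorem williamson_factor {ι : Type*} [Fintype ι] [DecidableEq ι] (A : Matrix ι ι ℝ)
    (hA : A.PosDef) : ∃ C : Matrix ι ι ℝ, A = star C * C :=
  CStarAlgebra.nonneg_iff_eq_star_mul_self.mp hA.posSemidef.nonneg

/-- Williamson's theorem: any real symmetric positive definite `2n × 2n` matrix is
taken to `diag(Σ, Σ)` by a symplectic congruence. -/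
theorem williamson (n : ℕ)
    (A : Matrix (Fin n ⊕ Fin n) (Fin n ⊕ Fin n) ℝ) (hA : A.PosDef) :
    ∃ (S : Matrix (Fin n ⊕ Fin n) (Fin n ⊕ Fin n) ℝ) (σ : Fin n → ℝ),
      Sᵀ * Matrix.fromBlocks 0 1 (-1) 0 * S = Matrix.fromBlocks 0 1 (-1) 0 ∧
      (∀ i, 0 < σ i) ∧
      S * A * Sᵀ = Matrix.fromBlocks (Matrix.diagonal σ) 0 0 (Matrix.diagonal σ) := by
  set J : Matrix (Fin n ⊕ Fin n) (Fin n ⊕ Fin n) ℝ := Matrix.fromBlocks 0 1 (-1) 0 with hJ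
  have hJT : Jᵀ = -J := by
    simp [hJ, Matrix.fromBlocks_transpose, Matrix.fromBlocks_neg]
  have hJJ : J * J = -1 := by
    rw [hJ, Matrix.fromBlocks_multiply, ← Matrix.fromBlocks_one, Matrix.fromBlocks_neg]
    simp
  obtain ⟨C, hC, hAC⟩ : ∃ C : Matrix (Fin n ⊕ Fin n) (Fin n ⊕ Fin n) ℝ,
      IsUnit C.det ∧ A = Cᵀ * C := by
    obtain ⟨C, hC⟩ := williamson_factor A hA
    rw [Matrix.star_eq_conjTranspose, Matrix.conjTranspose_eq_transpose_of_trivial] at hC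
    refine ⟨C, ?_, hC⟩
    have hd := hA.det_pos
    rw [hC, Matrix.det_mul, Matrix.det_transpose] at hd
    exact isUnit_iff_ne_zero.mpr (fun h => by simp [h] at hd)
  have hCT : IsUnit (Cᵀ).det := by rwa [Matrix.det_transpose]
  -- the skew matrix
  let K := (Cᵀ)⁻¹ * J * C⁻¹
  have hKT : Kᵀ = -K := by
    simp only [K, Matrix.transpose_mul, hJT, Matrix.transpose_nonsing_inv,
      Matrix.transpose_transpose, Matrix.mul_assoc, Matrix.neg_mul, Matrix.mul_neg]
  have hKinv : (-(C * J * Cᵀ)) * K = 1 := by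
    calc (-(C * J * Cᵀ)) * K = -(C * J * (Cᵀ * (Cᵀ)⁻¹) * J * C⁻¹) := by
          simp only [K, Matrix.mul_assoc, Matrix.neg_mul]
      _ = -(C * (J * J) * C⁻¹) := by
          rw [Matrix.mul_nonsing_inv _ hCT]; simp only [Matrix.mul_assoc, Matrix.one_mul]
      _ = 1 := by rw [hJJ]; simp [Matrix.mul_nonsing_inv _ hC]
  let T := Matrix.toEuclideanLin K
  have hin : ∀ x y : EuclideanSpace ℝ (Fin n ⊕ Fin n),
      inner ℝ x y = x.ofLp ⬝ᵥ y.ofLp := by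
    intro x y
    rw [EuclideanSpace.inner_eq_star_dotProduct, dotProduct_comm]
    simp
  have hTap : ∀ x : EuclideanSpace ℝ (Fin n ⊕ Fin n), (T x).ofLp = K *ᵥ x.ofLp := by
    intro x; rfl
  have hskew : ∀ x y, inner ℝ (T x) y = - inner ℝ x (T y) := by
    intro x y
    rw [hin, hin, hTap, hTap, dotProduct_mulVec, ← Matrix.mulVec_transpose, hKT,
      Matrix.neg_mulVec, neg_dotProduct, neg_neg]
  have hinj : ∀ x, T x = 0 → x = 0 := by
    intro x hx
    have h0 : K *ᵥ x.ofLp = 0 := by rw [← hTap, hx]; rfl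
    have : (-(C * J * Cᵀ)) *ᵥ (K *ᵥ x.ofLp) = x.ofLp := by
      rw [Matrix.mulVec_mulVec, hKinv, Matrix.one_mulVec]
    rw [h0, Matrix.mulVec_zero] at this
    ext i
    rw [← this]; rfl
  obtain ⟨u, σ, h1, h2, h3, h4, h5⟩ := williamson_family T hskew hinj n (by simp) n le_rfl
  have h23 : ∀ i j, inner ℝ (u i) (u j) = if i = j then σ i else 0 := by
    intro i j
    split_ifs with h
    · rw [← h, h2]
    · exact h3 i j h
  have h4' : ∀ i j, inner ℝ (T (u i)) (u j) = 0 := fun i j => by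
    rw [real_inner_comm, h4]
  let e : Fin n ⊕ Fin n → EuclideanSpace ℝ (Fin n ⊕ Fin n) :=
    Sum.elim u (fun i => -(σ i • T (u i)))
  let V : Matrix (Fin n ⊕ Fin n) (Fin n ⊕ Fin n) ℝ := Matrix.of (fun k => (e k).ofLp)
  have hVV : ∀ k l, (V * Vᵀ) k l = inner ℝ (e k) (e l) := by
    intro k l; rw [hin]; rfl
  have hVKV : ∀ k l, (V * (K * Vᵀ)) k l = inner ℝ (e k) (T (e l)) := by
    intro k l; rw [hin]; rfl
  have hTT : ∀ i j, inner ℝ (T (u i)) (T (u j)) = if i = j then (σ i)⁻¹ else 0 := by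
    intro i j
    rw [hskew, h5, inner_neg_right, real_inner_smul_right, h23, neg_neg]
    have := (h1 i).ne'
    split_ifs with h
    · subst h; field_simp
    · simp
  have hV1 : V * Vᵀ = Matrix.fromBlocks (Matrix.diagonal σ) 0 0 (Matrix.diagonal σ) := by
    ext k l
    rw [hVV]
    rcases k with i | i <;> rcases l with j | j
    · simp [e, h23, Matrix.diagonal_apply]
    · simp [e, real_inner_smul_right, inner_neg_right, h4]
    · simp [e, real_inner_smul_left, inner_neg_left, h4']
    · simp only [e, Sum.elim_inr, inner_neg_left, inner_neg_right, real_inner_smul_left,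
        real_inner_smul_right, hTT, Matrix.fromBlocks_apply₂₂, Matrix.diagonal_apply, neg_neg]
      have := (h1 i).ne'
      split_ifs with h
      · subst h; field_simp
      · simp
  have hV2 : V * (K * Vᵀ) = J := by
    ext k l
    rw [hVKV, hJ]
    rcases k with i | i <;> rcases l with j | j
    · simp [e, h4]
    · simp only [e, Sum.elim_inr, Sum.elim_inl, map_neg, map_smul, inner_neg_right,
        real_inner_smul_right, h5, h23, Matrix.fromBlocks_apply₁₂, Matrix.one_apply]
      have := (h1 i).ne'
      split_ifs with h
      · subst h; field_simp
      · simp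
    · simp only [e, Sum.elim_inr, Sum.elim_inl, inner_neg_left,
        real_inner_smul_left, hTT, Matrix.fromBlocks_apply₂₁, Matrix.neg_apply, Matrix.one_apply]
      have := (h1 i).ne'
      split_ifs with h
      · field_simp
      · simp
    · simp [e, h5, real_inner_smul_left, real_inner_smul_right, h4', inner_neg_left,
        inner_neg_right]
  refine ⟨V * (Cᵀ)⁻¹, σ, ?_, h1, ?_⟩
  · have hS : (V * (Cᵀ)⁻¹) * J * (V * (Cᵀ)⁻¹)ᵀ = J := by
      have hV2' := hV2
      simp only [K, Matrix.mul_assoc] at hV2'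
      simpa only [Matrix.transpose_mul, Matrix.transpose_nonsing_inv,
        Matrix.transpose_transpose, Matrix.mul_assoc] using hV2'
    have hJ' : J = -Matrix.J (Fin n) ℝ := by
      rw [hJ, Matrix.J, Matrix.fromBlocks_neg]; simp
    have hm : (V * (Cᵀ)⁻¹) ∈ Matrix.symplecticGroup (Fin n) ℝ := by
      rw [SymplecticGroup.mem_iff]
      rw [hJ'] at hS
      simpa using hS
    rw [SymplecticGroup.mem_iff'] at hm
    rw [hJ']
    simpa using hm
  · rw [← hV1, hAC]
    calc V * (Cᵀ)⁻¹ * (Cᵀ * C) * (V * (Cᵀ)⁻¹)ᵀ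
        = V * ((Cᵀ)⁻¹ * Cᵀ) * (C * C⁻¹) * Vᵀ := by
          simp only [Matrix.transpose_mul, Matrix.transpose_nonsing_inv,
            Matrix.transpose_transpose, Matrix.mul_assoc]
      _ = V * Vᵀ := by
          rw [Matrix.nonsing_inv_mul _ hCT, Matrix.mul_nonsing_inv _ hC]
          simp
end

section
/- (Takagi factorization) For any n×n complex symmetric matrix A (Aᵀ = A) there exist a unitary matrix U ∈ U(n) and a real nonnegative diagonal matrix Λ such that A = U Λ Uᵀ, where the transpose is the non-conjugated transpose. -/
open Matrix

/-- A conjugate-linear symmetric map has a coneigenvector in any nonzero invariant subspace. -/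
lemma takagi_exists_vec {V : Type*} [NormedAddCommGroup V] [InnerProductSpace ℂ V]
    [FiniteDimensional ℂ V] (T : V →ₛₗ[starRingEnd ℂ] V)
    (hT : ∀ x y, inner ℂ x (T y) = inner ℂ y (T x))
    (W : Submodule ℂ V) (hW : ∀ x ∈ W, T x ∈ W) (hne : W ≠ ⊥) :
    ∃ x ∈ W, ‖x‖ = 1 ∧ ∃ s : ℝ, 0 ≤ s ∧ T x = (s : ℂ) • x := by
  suffices h : ∃ x ∈ W, x ≠ 0 ∧ ∃ s : ℝ, 0 ≤ s ∧ T x = (s : ℂ) • x by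
    obtain ⟨x, hx, hx0, s, hs, h⟩ := h
    have hn : ‖x‖ ≠ 0 := norm_ne_zero_iff.mpr hx0
    refine ⟨((‖x‖⁻¹ : ℝ) : ℂ) • x, W.smul_mem _ hx, ?_, s, hs, ?_⟩
    · rw [norm_smul, Complex.norm_real, norm_inv, norm_norm, inv_mul_cancel₀ hn]
    · rw [LinearMap.map_smulₛₗ, h, Complex.conj_ofReal, smul_comm]
  let S : V →ₗ[ℂ] V := T.comp T
  have hS : ∀ x ∈ W, S x ∈ W := fun x hx => hW _ (hW _ hx)
  haveI : Nontrivial W := Submodule.nontrivial_iff_ne_bot.mpr hne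
  obtain ⟨μ, hμ⟩ := Module.End.exists_eigenvalue (S.restrict hS)
  obtain ⟨⟨x, hx⟩, hxe⟩ := hμ.exists_hasEigenvector
  have hx0 : x ≠ 0 := fun h => hxe.2 (Subtype.ext h)
  have hTT : T (T x) = μ • x := congrArg Subtype.val hxe.apply_eq_smul
  have hn : ‖x‖ ≠ 0 := norm_ne_zero_iff.mpr hx0
  have h1 : μ * ((‖x‖ : ℂ) ^ 2) = (‖T x‖ : ℂ) ^ 2 := by
    have := hT x (T x)
    rw [hTT, inner_smul_right, inner_self_eq_norm_sq_to_K, inner_self_eq_norm_sq_to_K] at this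
    exact this
  have hμ2 : μ = ((‖T x‖ / ‖x‖ : ℝ) : ℂ) * ((‖T x‖ / ‖x‖ : ℝ) : ℂ) := by
    have hn' : (‖x‖ : ℂ) ≠ 0 := by exact_mod_cast hn
    push_cast
    field_simp
    exact h1
  generalize hs : ‖T x‖ / ‖x‖ = s at hμ2
  have hs0 : 0 ≤ s := by rw [← hs]; positivity
  by_cases hy : T x + (s : ℂ) • x = 0
  · refine ⟨Complex.I • x, W.smul_mem _ hx, smul_ne_zero Complex.I_ne_zero hx0, s, hs0, ?_⟩
    rw [LinearMap.map_smulₛₗ, eq_neg_of_add_eq_zero_left hy, Complex.conj_I, smul_comm (s : ℂ)]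
    simp
  · refine ⟨_, W.add_mem (hW _ hx) (W.smul_mem _ hx), hy, s, hs0, ?_⟩
    rw [map_add, LinearMap.map_smulₛₗ, hTT, Complex.conj_ofReal, hμ2, smul_add, mul_smul, add_comm]

lemma takagi_family {V : Type*} [NormedAddCommGroup V] [InnerProductSpace ℂ V]
    [FiniteDimensional ℂ V] (T : V →ₛₗ[starRingEnd ℂ] V)
    (hT : ∀ x y, inner ℂ x (T y) = inner ℂ y (T x)) (k : ℕ) (hk : k ≤ Module.finrank ℂ V) :
    ∃ (v : Fin k → V) (s : Fin k → ℝ), Orthonormal ℂ v ∧ (∀ i, 0 ≤ s i) ∧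
      ∀ i, T (v i) = (s i : ℂ) • v i := by
  induction k with
  | zero => exact ⟨Fin.elim0, Fin.elim0, ⟨fun i => i.elim0, fun i => i.elim0⟩,
      fun i => i.elim0, fun i => i.elim0⟩
  | succ k ih =>
    obtain ⟨v, s, hv, hs, hvs⟩ := ih (by omega)
    let W := (Submodule.span ℂ (Set.range v))ᗮ
    have hmem : ∀ x, x ∈ W ↔ ∀ i, inner ℂ (v i) x = 0 := by
      intro x
      constructor
      · intro h i
        exact h (v i) (Submodule.subset_span ⟨i, rfl⟩)
      · intro h
        rw [Submodule.mem_orthogonal]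
        intro u hu
        induction hu using Submodule.span_induction with
        | mem y hy => obtain ⟨i, rfl⟩ := hy; exact h i
        | zero => simp
        | add a b _ _ ha hb => rw [inner_add_left, ha, hb, add_zero]
        | smul c a _ ha => rw [inner_smul_left, ha, mul_zero]
    have hW : ∀ x ∈ W, T x ∈ W := by
      intro x hx
      rw [hmem] at hx ⊢
      intro i
      rw [hT, hvs, inner_smul_right, inner_eq_zero_symm.mp (hx i), mul_zero]
    have hne : W ≠ ⊥ := by
      intro h
      have h2 := Submodule.finrank_add_finrank_orthogonal (Submodule.span ℂ (Set.range v))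
      rw [show (Submodule.span ℂ (Set.range v))ᗮ = ⊥ from h, finrank_bot,
        finrank_span_eq_card hv.linearIndependent, Fintype.card_fin] at h2
      omega
    obtain ⟨x, hx, hx1, t, ht, hxt⟩ := takagi_exists_vec T hT W hW hne
    rw [hmem] at hx
    refine ⟨Fin.cons x v, Fin.cons t s, ?_, ?_, ?_⟩
    · rw [orthonormal_iff_ite] at hv ⊢
      intro i j
      refine Fin.cases ?_ (fun i => ?_) i <;> refine Fin.cases ?_ (fun j => ?_) j
      · simp [inner_self_eq_norm_sq_to_K, hx1]
      · simp [inner_eq_zero_symm.mp (hx j), (Fin.succ_ne_zero j).symm]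
      · simp [hx i]
      · simp [hv i j]
    · intro i
      refine Fin.cases ?_ (fun i => ?_) i <;> simp [ht, hs]
    · intro i
      refine Fin.cases ?_ (fun i => ?_) i <;> simp [hxt, hvs]

/-- Takagi factorization: any complex symmetric matrix `A = Aᵀ` can be written as
`A = U Λ Uᵀ` with `U` unitary and `Λ` real nonnegative diagonal. -/
theorem takagi_factorization (n : ℕ) (A : Matrix (Fin n) (Fin n) ℂ)
    (hsym : Aᵀ = A) :
    ∃ (U : Matrix (Fin n) (Fin n) ℂ) (Λ : Fin n → ℝ),
      Uᴴ * U = 1 ∧ (∀ i, 0 ≤ Λ i) ∧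
      A = U * Matrix.diagonal (fun i => (Λ i : ℂ)) * Uᵀ := by
  let T : EuclideanSpace ℂ (Fin n) →ₛₗ[starRingEnd ℂ] EuclideanSpace ℂ (Fin n) :=
    { toFun := fun x => WithLp.toLp 2 (A *ᵥ star x.ofLp)
      map_add' := by
        intro x y
        simp [Matrix.mulVec_add]
      map_smul' := by
        intro c x
        simp [Matrix.mulVec_smul] }
  have hTa : ∀ x, (T x).ofLp = A *ᵥ star x.ofLp := fun x => rfl
  have hT : ∀ x y, inner ℂ x (T y) = inner ℂ y (T x) := by
    intro x y
    rw [EuclideanSpace.inner_eq_star_dotProduct, EuclideanSpace.inner_eq_star_dotProduct,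
      hTa, hTa, dotProduct_comm, Matrix.dotProduct_mulVec, ← Matrix.mulVec_transpose, hsym]
  obtain ⟨v, s, hv, hs, hvs⟩ := takagi_family T hT n (by simp)
  let U : Matrix (Fin n) (Fin n) ℂ := Matrix.of fun i j => v j i
  have hU : Uᴴ * U = 1 := by
    ext i j
    have := (orthonormal_iff_ite.mp hv) i j
    rw [EuclideanSpace.inner_eq_star_dotProduct] at this
    rw [Matrix.one_apply, ← this, Matrix.mul_apply, dotProduct]
    exact Finset.sum_congr rfl fun k _ => mul_comm _ _
  refine ⟨U, s, hU, hs, ?_⟩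
  have h1 : A * Uᴴᵀ = U * Matrix.diagonal (fun i => (s i : ℂ)) := by
    ext i j
    have := congrFun (congrArg WithLp.ofLp (hvs j)) i
    rw [hTa] at this
    rw [Matrix.mul_diagonal, mul_comm]
    exact this
  have h2 : Uᴴᵀ * Uᵀ = 1 := by
    rw [← Matrix.transpose_mul, mul_eq_one_comm.mp hU, Matrix.transpose_one]
  rw [← h1, Matrix.mul_assoc, h2, Matrix.mul_one]
end

section
/- (F8, real) Let n = p + q with p ≥ q. Any n×n real invertible matrix G can be factored as G = O · H · diag(G_p, G_q), where O ∈ O(n), G_p ∈ GL(p, ℝ), G_q ∈ GL(q, ℝ), and H = [[Ch, 0, Sh], [0, I_{p−q}, 0], [Sh, 0, Ch]] with Ch = diag(cosh θ_l), Sh = diag(sinh θ_l) for real numbers θ_1, …, θ_q. -/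
open Matrix

theorem f8_factor {n : Type*} [Fintype n] [DecidableEq n] {A : Matrix n n ℝ} (hA : A.PosDef) :
    ∃ X : Matrix n n ℝ, IsUnit X.det ∧ A = Xᵀ * X := by
  have hs := hA.isHermitian.spectral_theorem
  rw [Unitary.conjStarAlgAut_apply] at hs
  set U : Matrix n n ℝ := (hA.isHermitian.eigenvectorUnitary : Matrix n n ℝ) with hU
  set e := hA.isHermitian.eigenvalues with he
  have h1 : A = (diagonal (fun i => √(e i)) * Uᵀ)ᵀ * (diagonal (fun i => √(e i)) * Uᵀ) := by
    rw [transpose_mul, transpose_transpose, diagonal_transpose]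
    have : (diagonal (fun i => √(e i)) * diagonal (fun i => √(e i)) : Matrix n n ℝ)
        = diagonal (RCLike.ofReal ∘ e) := by
      rw [diagonal_mul_diagonal]
      congr 1
      ext i
      simp [Real.mul_self_sqrt (hA.eigenvalues_pos i).le, he]
    calc A = U * diagonal (RCLike.ofReal ∘ e) * Uᵀ := hs
      _ = _ := by rw [← this]; simp only [Matrix.mul_assoc]
  refine ⟨_, ?_, h1⟩
  have h2 := (Matrix.isUnit_iff_isUnit_det A).1 hA.isUnit
  rw [h1, det_mul] at h2
  exact (IsUnit.mul_iff.1 h2).2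

theorem f8_svd {m r : Type*} [Fintype m] [DecidableEq m] [Fintype r] [DecidableEq r]
    (M : Matrix (m ⊕ r) m ℝ) :
    ∃ (U : Matrix (m ⊕ r) (m ⊕ r) ℝ) (V : Matrix m m ℝ) (σ : m → ℝ),
      Uᵀ * U = 1 ∧ Vᵀ * V = 1 ∧ (∀ i, 0 ≤ σ i) ∧ M = U * (fromRows (diagonal σ) 0 : Matrix (m ⊕ r) m ℝ) * Vᵀ := by
  have hH : (Mᵀ * M).IsHermitian := isHermitian_conjTranspose_mul_self M
  have hs := hH.conjStarAlgAut_star_eigenvectorUnitary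
  rw [Unitary.conjStarAlgAut_star_apply] at hs
  set V : Matrix m m ℝ := (hH.eigenvectorUnitary : Matrix m m ℝ) with hV
  set e := hH.eigenvalues with he
  have hVV : Vᵀ * V = 1 := Unitary.coe_star_mul_self hH.eigenvectorUnitary
  have hVV' : V * Vᵀ = 1 := mul_eq_one_comm.1 hVV
  have he0 : ∀ i, 0 ≤ e i := fun i => eigenvalues_conjTranspose_mul_self_nonneg M i
  have hN : (M * V)ᵀ * (M * V) = diagonal e := by
    rw [transpose_mul]
    have : Vᵀ * (Mᵀ * M) * V = diagonal e := hs
    rw [← this]; simp only [Matrix.mul_assoc]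
  set N := M * V with hNdef
  have hNij : ∀ i j, ∑ k, N k i * N k j = if i = j then e i else 0 := by
    intro i j
    have := congrFun (congrFun hN i) j
    simpa [Matrix.mul_apply, diagonal_apply] using this
  let v : m ⊕ r → EuclideanSpace ℝ (m ⊕ r) :=
    Sum.elim (fun j => WithLp.toLp 2 (fun k => (√(e j))⁻¹ * N k j)) (fun _ => 0)
  let s : Set (m ⊕ r) := {x | ∃ j, x = Sum.inl j ∧ e j ≠ 0}
  have hv : Orthonormal ℝ (s.domRestrict v) := by
    rw [orthonormal_iff_ite]
    rintro ⟨_, i, rfl, hi⟩ ⟨_, j, rfl, hj⟩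
    have : inner ℝ (v (Sum.inl i)) (v (Sum.inl j))
        = (√(e i))⁻¹ * (√(e j))⁻¹ * ∑ k, N k i * N k j := by
      simp only [v, Sum.elim_inl, PiLp.inner_apply, Finset.mul_sum]
      refine Finset.sum_congr rfl fun k _ => ?_
      simp
      ring
    simp only [Set.domRestrict_apply, Subtype.mk.injEq, Sum.inl.injEq]
    rw [this, hNij]
    by_cases hij : i = j
    · subst hij
      simp only [if_true]
      have h0 : √(e i) ≠ 0 := (Real.sqrt_ne_zero (he0 i)).2 hi
      have := Real.mul_self_sqrt (he0 i)
      field_simp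
      nlinarith
    · simp [hij]
  obtain ⟨b, hb⟩ := hv.exists_orthonormalBasis_extension_of_card_eq (by simp)
  let U : Matrix (m ⊕ r) (m ⊕ r) ℝ := of fun k i => b i k
  refine ⟨U, V, fun i => √(e i), ?_, hVV, fun i => Real.sqrt_nonneg _, ?_⟩
  · ext i j
    have := orthonormal_iff_ite.1 b.orthonormal i j
    simp only [PiLp.inner_apply] at this
    simp only [Matrix.mul_apply, transpose_apply, U, of_apply, one_apply]
    rw [← this]
    refine Finset.sum_congr rfl fun k _ => ?_
    simp
    ring
  · have key : N = U * (fromRows (diagonal fun i => √(e i)) 0 : Matrix (m ⊕ r) m ℝ) := by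
      ext k j
      have h1 : (U * (fromRows (diagonal fun i => √(e i)) 0 : Matrix (m ⊕ r) m ℝ)) k j = U k (Sum.inl j) * √(e j) := by
        simp [Matrix.mul_apply, diagonal_apply]
      rw [h1]
      by_cases hj : e j = 0
      · have h2 := hNij j j
        rw [if_pos rfl, hj] at h2
        have h3 := (Finset.sum_eq_zero_iff_of_nonneg
          (fun k _ => mul_self_nonneg (N k j))).1 h2 k (Finset.mem_univ _)
        rw [hj, Real.sqrt_zero, mul_zero]
        exact mul_self_eq_zero.1 h3
      · have h0 : √(e j) ≠ 0 := (Real.sqrt_ne_zero (he0 j)).2 hj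
        simp only [U, of_apply]
        rw [hb (Sum.inl j) ⟨j, rfl, hj⟩]
        simp only [v, Sum.elim_inl]
        field_simp
    rw [← key, hNdef, Matrix.mul_assoc, hVV', Matrix.mul_one]

/-- Simultaneous normal form of a positive definite block matrix. -/
theorem f8_normal {m r : Type*} [Fintype m] [DecidableEq m] [Fintype r] [DecidableEq r]
    (S : Matrix ((m ⊕ r) ⊕ m) ((m ⊕ r) ⊕ m) ℝ) (hS : S.PosDef) :
    ∃ (P : Matrix (m ⊕ r) (m ⊕ r) ℝ) (Q : Matrix m m ℝ) (σ : m → ℝ),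
      IsUnit P.det ∧ IsUnit Q.det ∧ (∀ i, 0 ≤ σ i) ∧ (∀ i, σ i < 1) ∧
      S = fromBlocks (Pᵀ * P) (Pᵀ * (fromRows (diagonal σ) 0 : Matrix (m ⊕ r) m ℝ) * Q)
        (Qᵀ * (fromCols (diagonal σ) 0 : Matrix m (m ⊕ r) ℝ) * P) (Qᵀ * Q) := by
  obtain ⟨X, hX, hA⟩ := f8_factor (A := S.toBlocks₁₁) (hS.submatrix Sum.inl_injective)
  obtain ⟨Y, hY, hD⟩ := f8_factor (A := S.toBlocks₂₂) (hS.submatrix Sum.inr_injective)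
  obtain ⟨U, V, σ, hU, hV, h0, hM⟩ := f8_svd (Xᵀ⁻¹ * S.toBlocks₁₂ * Y⁻¹)
  have hU' : U * Uᵀ = 1 := mul_eq_one_comm.1 hU
  have hV' : V * Vᵀ = 1 := mul_eq_one_comm.1 hV
  have hXt : IsUnit (Xᵀ).det := by rwa [det_transpose]
  have hUd : IsUnit (Uᵀ).det := by
    have := congrArg det hU
    rw [det_mul, det_one] at this
    exact IsUnit.of_mul_eq_one _ this
  have hVd : IsUnit (Vᵀ).det := by
    have := congrArg det hV
    rw [det_mul, det_one] at this
    exact IsUnit.of_mul_eq_one _ this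
  have hB : S.toBlocks₁₂ = (Uᵀ * X)ᵀ * (fromRows (diagonal σ) 0 : Matrix (m ⊕ r) m ℝ) * (Vᵀ * Y) := by
    calc S.toBlocks₁₂ = Xᵀ * (Xᵀ⁻¹ * S.toBlocks₁₂ * Y⁻¹) * Y := by
          rw [Matrix.mul_assoc Xᵀ⁻¹, Matrix.mul_nonsing_inv_cancel_left _ _ hXt,
            Matrix.nonsing_inv_mul_cancel_right _ _ hY]
      _ = _ := by rw [hM, transpose_mul, transpose_transpose]; simp only [Matrix.mul_assoc]
  have hC : S.toBlocks₂₁ = (Vᵀ * Y)ᵀ * (fromCols (diagonal σ) 0 : Matrix m (m ⊕ r) ℝ) * (Uᵀ * X) := by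
    have h1 : S.toBlocks₂₁ = (S.toBlocks₁₂)ᵀ := by
      ext i j
      have := hS.isHermitian.apply (Sum.inr i) (Sum.inl j)
      simpa [toBlocks₂₁, toBlocks₁₂] using this.symm
    rw [h1, hB]
    simp only [transpose_mul, transpose_transpose, transpose_fromRows, diagonal_transpose,
      transpose_zero, Matrix.mul_assoc]
  have hA' : S.toBlocks₁₁ = (Uᵀ * X)ᵀ * (Uᵀ * X) := by
    rw [hA, transpose_mul, transpose_transpose, Matrix.mul_assoc, ← Matrix.mul_assoc U, hU',
      Matrix.one_mul]
  have hD' : S.toBlocks₂₂ = (Vᵀ * Y)ᵀ * (Vᵀ * Y) := by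
    rw [hD, transpose_mul, transpose_transpose, Matrix.mul_assoc, ← Matrix.mul_assoc V, hV',
      Matrix.one_mul]
  have hP : IsUnit (Uᵀ * X).det := by rw [det_mul]; exact hUd.mul hX
  have hQ : IsUnit (Vᵀ * Y).det := by rw [det_mul]; exact hVd.mul hY
  generalize Uᵀ * X = P at *
  generalize Vᵀ * Y = Q at *
  have hSeq : S = fromBlocks (Pᵀ * P) (Pᵀ * (fromRows (diagonal σ) 0 : Matrix (m ⊕ r) m ℝ) * Q)
        (Qᵀ * (fromCols (diagonal σ) 0 : Matrix m (m ⊕ r) ℝ) * P) (Qᵀ * Q) := by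
    rw [← fromBlocks_toBlocks S, hA', hB, hC, hD']
  refine ⟨P, Q, σ, hP, hQ, h0, fun j => ?_, hSeq⟩
  have hW : IsUnit (fromBlocks P 0 0 Q) := by
    rw [Matrix.isUnit_iff_isUnit_det, det_fromBlocks_zero₂₁]
    exact hP.mul hQ
  have hpd : (fromBlocks 1 ((fromRows (diagonal σ) 0 : Matrix (m ⊕ r) m ℝ)) ((fromCols (diagonal σ) 0 : Matrix m (m ⊕ r) ℝ)) 1 :
      Matrix ((m ⊕ r) ⊕ m) ((m ⊕ r) ⊕ m) ℝ).PosDef := by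
    rw [← Matrix.IsUnit.posDef_star_left_conjugate_iff hW]
    convert hS using 1
    rw [hSeq, star_eq_conjTranspose, fromBlocks_conjTranspose]
    simp [fromBlocks_multiply, conjTranspose_eq_transpose_of_trivial]
  have hx : (Sum.elim (Sum.elim (Pi.single j 1) 0) (-Pi.single j 1) : (m ⊕ r) ⊕ m → ℝ) ≠ 0 := by
    intro h
    have := congrFun h (Sum.inl (Sum.inl j))
    simp at this
  have := hpd.dotProduct_mulVec_pos hx
  simp [fromBlocks_mulVec, fromRows_mulVec, fromCols_mulVec, dotProduct, mulVec,
    Fintype.sum_sum_type, Pi.single_apply, diagonal_apply, one_apply] at this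
  linarith






theorem f8_hyp {m r : Type*} [Fintype m] [DecidableEq m] [Fintype r] [DecidableEq r]
    (c s d σ : m → ℝ) (h1 : ∀ i, d i * (c i * c i + s i * s i) * d i = 1)
    (h2 : ∀ i, d i * (c i * s i + s i * c i) * d i = σ i)
    (H D : Matrix ((m ⊕ r) ⊕ m) ((m ⊕ r) ⊕ m) ℝ)
    (hH : H = fromBlocks (fromBlocks (diagonal c) 0 0 1) (fromRows (diagonal s) 0)
      (fromCols (diagonal s) 0) (diagonal c))
    (hD : D = fromBlocks (fromBlocks (diagonal d) 0 0 1) 0 0 (diagonal d)) :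
    D * (H * H) * D = fromBlocks 1 (fromRows (diagonal σ) 0) (fromCols (diagonal σ) 0) 1 := by
  subst hH hD
  have h3 : ∀ i, d i * (s i * c i + c i * s i) * d i = σ i := fun i => by
    rw [← h2]; ring
  have h4 : ∀ i, d i * (s i * s i + c i * c i) * d i = 1 := fun i => by
    rw [← h1 i]; ring
  ext ((i | i) | i) ((j | j) | j) <;>
    simp [Matrix.mul_apply, Fintype.sum_sum_type, diagonal_apply, one_apply] <;>
    (try split_ifs) <;> simp_all

/-- F8 (real): any invertible real `(p+q) × (p+q)` matrix `G` (with `p ≥ q` and the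
index set realized as `(Fin q ⊕ Fin (p-q)) ⊕ Fin q`) factors as
`G = O · [[Ch, 0, Sh], [0, I, 0], [Sh, 0, Ch]] · diag(G_p, G_q)`. -/
theorem f8_real (p q : ℕ) (hpq : q ≤ p)
    (G : Matrix ((Fin q ⊕ Fin (p - q)) ⊕ Fin q) ((Fin q ⊕ Fin (p - q)) ⊕ Fin q) ℝ)
    (hG : IsUnit G.det) :
    ∃ (O : Matrix ((Fin q ⊕ Fin (p - q)) ⊕ Fin q) ((Fin q ⊕ Fin (p - q)) ⊕ Fin q) ℝ)
      (Gp : Matrix (Fin q ⊕ Fin (p - q)) (Fin q ⊕ Fin (p - q)) ℝ)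
      (Gq : Matrix (Fin q) (Fin q) ℝ) (θ : Fin q → ℝ),
      Oᵀ * O = 1 ∧ IsUnit Gp.det ∧ IsUnit Gq.det ∧
      G = O *
          Matrix.fromBlocks
            (Matrix.fromBlocks (Matrix.diagonal fun l => Real.cosh (θ l)) 0 0 1)
            (Matrix.of fun i j => match i with
              | Sum.inl i' => if i' = j then Real.sinh (θ j) else 0
              | Sum.inr _ => 0)
            (Matrix.of fun i j => match j with
              | Sum.inl j' => if i = j' then Real.sinh (θ i) else 0
              | Sum.inr _ => 0)
            (Matrix.diagonal fun l => Real.cosh (θ l)) *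
          Matrix.fromBlocks Gp 0 0 Gq := by
  have hGu : IsUnit G := (Matrix.isUnit_iff_isUnit_det G).2 hG
  have hS : (Gᵀ * G).PosDef := by
    have := (Matrix.IsUnit.posDef_star_left_conjugate_iff (x := (1 : Matrix _ _ ℝ)) hGu).2
      Matrix.PosDef.one
    simpa [star_eq_conjTranspose, conjTranspose_eq_transpose_of_trivial] using this
  obtain ⟨P, Q, σ, hP, hQ, h0, h1, hSeq⟩ := f8_normal _ hS
  let θ : Fin q → ℝ := fun i => Real.artanh (σ i) / 2
  have htwo : ∀ i, 2 * θ i = Real.artanh (σ i) := fun i => by simp only [θ]; ring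
  let d : Fin q → ℝ := fun i => (√(Real.cosh (2 * θ i)))⁻¹
  have hd : ∀ i, d i * d i = (Real.cosh (2 * θ i))⁻¹ := fun i => by
    simp only [d]
    rw [← mul_inv, Real.mul_self_sqrt (Real.cosh_pos _).le]
  have hdpos : ∀ i, 0 < d i := fun i => inv_pos.2 (Real.sqrt_pos.2 (Real.cosh_pos _))
  have hc : ∀ i, d i * (Real.cosh (θ i) * Real.cosh (θ i) + Real.sinh (θ i) * Real.sinh (θ i))
      * d i = 1 := fun i => by
    have : Real.cosh (θ i) * Real.cosh (θ i) + Real.sinh (θ i) * Real.sinh (θ i)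
        = Real.cosh (2 * θ i) := by rw [Real.cosh_two_mul]; ring
    rw [this, mul_right_comm, hd, inv_mul_cancel₀ (Real.cosh_pos _).ne']
  have hs : ∀ i, d i * (Real.cosh (θ i) * Real.sinh (θ i) + Real.sinh (θ i) * Real.cosh (θ i))
      * d i = σ i := fun i => by
    have : Real.cosh (θ i) * Real.sinh (θ i) + Real.sinh (θ i) * Real.cosh (θ i)
        = Real.sinh (2 * θ i) := by rw [Real.sinh_two_mul]; ring
    rw [this, mul_right_comm, hd, mul_comm, ← div_eq_mul_inv, ← Real.tanh_eq_sinh_div_cosh, htwo]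
    exact Real.tanh_artanh ⟨by linarith [h0 i], h1 i⟩
  set H : Matrix ((Fin q ⊕ Fin (p - q)) ⊕ Fin q) ((Fin q ⊕ Fin (p - q)) ⊕ Fin q) ℝ :=
    fromBlocks (fromBlocks (diagonal fun l => Real.cosh (θ l)) 0 0 1)
      (fromRows (diagonal fun l => Real.sinh (θ l)) 0)
      (fromCols (diagonal fun l => Real.sinh (θ l)) 0)
      (diagonal fun l => Real.cosh (θ l)) with hH
  set D : Matrix ((Fin q ⊕ Fin (p - q)) ⊕ Fin q) ((Fin q ⊕ Fin (p - q)) ⊕ Fin q) ℝ :=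
    fromBlocks (fromBlocks (diagonal d) 0 0 1) 0 0 (diagonal d) with hD
  have hDHD := f8_hyp _ _ d σ hc hs H D hH hD
  have hHt : Hᵀ = H := by
    simp [hH, fromBlocks_transpose, transpose_fromRows, transpose_fromCols]
  have hDt : Dᵀ = D := by
    simp [hD, fromBlocks_transpose]
  let Gp : Matrix (Fin q ⊕ Fin (p - q)) (Fin q ⊕ Fin (p - q)) ℝ :=
    fromBlocks (diagonal d) 0 0 1 * P
  let Gq : Matrix (Fin q) (Fin q) ℝ := diagonal d * Q
  have hDW : fromBlocks Gp 0 0 Gq = D * fromBlocks P 0 0 Q := by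
    simp [hD, Gp, Gq, fromBlocks_multiply]
  have hdd : IsUnit (diagonal d).det := by
    rw [det_diagonal, isUnit_iff_ne_zero]
    exact Finset.prod_ne_zero_iff.2 fun i _ => (hdpos i).ne'
  have hKK : (H * fromBlocks Gp 0 0 Gq)ᵀ * (H * fromBlocks Gp 0 0 Gq) = Gᵀ * G := by
    rw [hDW]
    calc _ = (fromBlocks P 0 0 Q)ᵀ * (D * (H * H) * D) * fromBlocks P 0 0 Q := by
          simp only [transpose_mul, hHt, hDt, Matrix.mul_assoc]
      _ = _ := by
          rw [hDHD, hSeq]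
          simp [fromBlocks_multiply, fromBlocks_transpose]
  have hHeq : fromBlocks
            (Matrix.fromBlocks (Matrix.diagonal fun l => Real.cosh (θ l)) 0 0 1)
            (Matrix.of fun i j => match i with
              | Sum.inl i' => if i' = j then Real.sinh (θ j) else 0
              | Sum.inr _ => 0)
            (Matrix.of fun i j => match j with
              | Sum.inl j' => if i = j' then Real.sinh (θ i) else 0
              | Sum.inr _ => 0)
            (Matrix.diagonal fun l => Real.cosh (θ l)) = H := by
    rw [hH]
    congr 1
    · ext (i | i) j
      · by_cases hij : i = j <;> simp [diagonal_apply, hij]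
      · simp
    · ext i (j | j)
      · by_cases hij : i = j <;> simp [diagonal_apply, hij]
      · simp
  have hKu : IsUnit (H * fromBlocks Gp 0 0 Gq).det := by
    have := congrArg det hKK
    rw [det_mul, det_mul Gᵀ, det_transpose G] at this
    have h3 : IsUnit (G.det * G.det) := hG.mul hG
    rw [← this] at h3
    exact (IsUnit.mul_iff.1 h3).2
  refine ⟨G * (H * fromBlocks Gp 0 0 Gq)⁻¹, Gp, Gq, θ, ?_, ?_, ?_, ?_⟩
  · generalize H * fromBlocks Gp 0 0 Gq = K at *
    have hKt : IsUnit (Kᵀ).det := by rwa [det_transpose]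
    calc (G * K⁻¹)ᵀ * (G * K⁻¹) = (Kᵀ)⁻¹ * (Gᵀ * G) * K⁻¹ := by
          rw [transpose_mul, transpose_nonsing_inv]; simp only [Matrix.mul_assoc]
      _ = 1 := by
          rw [← hKK, Matrix.nonsing_inv_mul_cancel_left _ _ hKt, Matrix.mul_nonsing_inv _ hKu]
  · simp only [Gp]
    rw [det_mul, det_fromBlocks_zero₂₁, det_one, mul_one]
    exact hdd.mul hP
  · simp only [Gq]
    rw [det_mul]
    exact hdd.mul hQ
  · rw [hHeq, Matrix.mul_assoc, Matrix.nonsing_inv_mul_cancel_right _ _ hKu]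
end
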